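/- arXiv:2209.09598 — 2 statements merged into one kernel-verified Lean document; each statement's English description precedes it below -/
import Mathlib

section
/- There exists an infinite binary word w that is γ'⁺-free, where γ' = 2 + 1/(β₁² − 1) and β₁ is the unique real root of t³ − 2t² + t − 1, such that the set of nonempty binary words x for which both x and its complement x̄ are factors of w has at most 64 elements. -/
/-- `x` occurs as a contiguous block in the infinite word `w : ℕ → α`. -/
def FactorN {α : Type*} (w : ℕ → α) (x : List α) : Prop :=
  ∃ i : ℕ, x = (List.range x.length).map fun k => w (i + k)

/-- the finite word `u` has period `p ≥ 1`. -/
def HasPeriod {α : Type*} (u : List α) (p : ℕ) : Prop :=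
  1 ≤ p ∧ ∀ i : ℕ, i + p < u.length → u[i]? = u[i + p]?

/-- the smallest period of `u`. -/
noncomputable def minPeriod {α : Type*} (u : List α) : ℕ :=
  sInf {p | HasPeriod u p}

/-- the exponent of `u`: its length divided by its smallest period. -/
noncomputable def expo {α : Type*} (u : List α) : ℝ :=
  (u.length : ℝ) / (minPeriod u : ℝ)

/-- the complement of a binary word: each letter is flipped. -/
def comp (x : List Bool) : List Bool := x.map fun b => !b

namespace ComplementAvoidance

/-! ### Concatenations of blocks -/

/-- The infinite word `x` is the concatenation of the nonempty blocks `b 0, b 1, …`, and `c j`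
is the position at which the block `b j` starts. -/
structure IsConcat {α : Type*} (x : ℕ → α) (b : ℕ → List α) (c : ℕ → ℕ) : Prop where
  start_zero : c 0 = 0
  start_succ : ∀ j, c (j + 1) = c j + (b j).length
  length_pos : ∀ j, 0 < (b j).length
  letter : ∀ j r, r < (b j).length → (b j)[r]? = some (x (c j + r))

namespace IsConcat

variable {α : Type*} {x : ℕ → α} {b : ℕ → List α} {c : ℕ → ℕ}

theorem start_strictMono (h : IsConcat x b c) : StrictMono c :=
  strictMono_nat_of_lt_succ fun j => by
    have := h.start_succ j
    have := h.length_pos j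
    omega

theorem exists_block (h : IsConcat x b c) (n : ℕ) : ∃ j, c j ≤ n ∧ n < c (j + 1) := by
  induction n with
  | zero =>
    have := h.start_zero
    have : c 0 < c (0 + 1) := h.start_strictMono (Nat.lt_succ_self 0)
    exact ⟨0, by omega, by omega⟩
  | succ n ih =>
    obtain ⟨j, h1, h2⟩ := ih
    by_cases h3 : n + 1 < c (j + 1)
    · exact ⟨j, by omega, h3⟩
    · have : c (j + 1) < c (j + 1 + 1) := h.start_strictMono (Nat.lt_succ_self _)
      exact ⟨j + 1, by omega, by omega⟩

end IsConcat

/-- The concatenation of the first `n` blocks. -/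
def concatPrefix {α : Type*} (b : ℕ → List α) : ℕ → List α
  | 0 => []
  | n + 1 => concatPrefix b n ++ b n

theorem concatPrefix_mono {α : Type*} (b : ℕ → List α) {m n : ℕ} (h : m ≤ n) :
    concatPrefix b m <+: concatPrefix b n := by
  induction n, h using Nat.le_induction with
  | base => exact List.prefix_rfl
  | succ n _ ih => exact ih.trans (List.prefix_append _ _)

theorem isConcat_of_concatPrefix {α : Type*} {x : ℕ → α} {b : ℕ → List α}
    (hb : ∀ j, 0 < (b j).length)
    (hx : ∀ n, (concatPrefix b (n + 1))[n]? = some (x n)) :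
    IsConcat x b fun j => (concatPrefix b j).length where
  start_zero := rfl
  start_succ j := by simp [concatPrefix]
  length_pos := hb
  letter j r hr := by
    have h1 : (concatPrefix b (j + 1))[(concatPrefix b j).length + r]? = (b j)[r]? := by
      simp [concatPrefix, List.getElem?_append_right]
    rw [← hx, ← h1]
    have h2 : (concatPrefix b j).length + r < (concatPrefix b (j + 1)).length := by
      simp [concatPrefix, hr]
    generalize (concatPrefix b j).length + r = n at h2 ⊢
    have h3 : ∀ m, m ≤ (concatPrefix b m).length := by
      intro m
      induction m with
      | zero => simp
      | succ m ih => have := hb m; simp [concatPrefix]; omega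
    have h4 : n < (concatPrefix b (n + 1)).length := h3 (n + 1)
    rw [List.getElem?_eq_getElem h2, List.getElem?_eq_getElem h4]
    rcases le_total (j + 1) (n + 1) with h | h
    · rw [(concatPrefix_mono b h).getElem h2]
    · rw [(concatPrefix_mono b h).getElem h4]

/-! ### The ternary fixed point and its binary image -/

/-- The morphism `0 ↦ 01, 1 ↦ 21, 2 ↦ 0`. -/
def subst : Fin 3 → List (Fin 3)
  | 0 => [0, 1]
  | 1 => [2, 1]
  | 2 => [0]

/-- The morphism `0 ↦ 011001, 1 ↦ 0, 2 ↦ 01101`. -/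
def code : Fin 3 → List Bool
  | 0 => [false, true, true, false, false, true]
  | 1 => [false]
  | 2 => [false, true, true, false, true]

theorem subst_length_pos (a : Fin 3) : 0 < (subst a).length := by
  fin_cases a <;> simp [subst]

theorem code_length_pos (a : Fin 3) : 0 < (code a).length := by
  fin_cases a <;> simp [code]

/-- Prefixes of the fixed point of `subst`: each stage appends the image of the next unread
letter. -/
def ternaryPrefix : ℕ → List (Fin 3)
  | 0 => [0, 1]
  | n + 1 => ternaryPrefix n ++ subst ((ternaryPrefix n).getD (n + 1) 0)

/-- The fixed point of `subst` starting with `0`. -/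
def ternary (n : ℕ) : Fin 3 := (ternaryPrefix n).getD n 0

theorem lt_length_ternaryPrefix (n : ℕ) : n + 1 < (ternaryPrefix n).length := by
  induction n with
  | zero => simp [ternaryPrefix]
  | succ n ih =>
    have := subst_length_pos ((ternaryPrefix n).getD (n + 1) 0)
    rw [ternaryPrefix, List.length_append]
    omega

theorem ternaryPrefix_getD_succ (n : ℕ) : (ternaryPrefix n).getD (n + 1) 0 = ternary (n + 1) := by
  have := lt_length_ternaryPrefix n
  simp [ternary, ternaryPrefix, List.getElem?_append_left this]

theorem ternaryPrefix_eq (n : ℕ) :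
    ternaryPrefix n = concatPrefix (fun j => subst (ternary j)) (n + 1) := by
  induction n with
  | zero => rfl
  | succ n ih => rw [ternaryPrefix, ternaryPrefix_getD_succ, ih, concatPrefix.eq_2 _ (n + 1)]

/-- The position at which the image of the `j`-th letter starts in `ternary`. -/
def cut (j : ℕ) : ℕ := (concatPrefix (fun j => subst (ternary j)) j).length

theorem isConcat_ternary : IsConcat ternary (fun j => subst (ternary j)) cut :=
  isConcat_of_concatPrefix (fun _ => subst_length_pos _) fun n => by
    have := lt_length_ternaryPrefix n
    rw [← ternaryPrefix_eq, ternary, List.getD_eq_getElem?_getD,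
      List.getElem?_eq_getElem (by omega)]
    rfl

/-- The binary word `code (ternary)`. -/
def binary (n : ℕ) : Bool := (concatPrefix (fun j => code (ternary j)) (n + 1)).getD n false

/-- The position at which the code of the `j`-th letter starts in `binary`. -/
def codeCut (j : ℕ) : ℕ := (concatPrefix (fun j => code (ternary j)) j).length

theorem isConcat_binary : IsConcat binary (fun j => code (ternary j)) codeCut :=
  isConcat_of_concatPrefix (fun _ => code_length_pos _) fun n => by
    have h : ∀ m, m ≤ (concatPrefix (fun j => code (ternary j)) m).length := by
      intro m
      induction m with
      | zero => simp
      | succ m ih => have := code_length_pos (ternary m); simp [concatPrefix]; omega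
    rw [binary, List.getD_eq_getElem?_getD, List.getElem?_eq_getElem (h (n + 1))]
    rfl

theorem ternary_cases (j : ℕ) : ternary j = 0 ∨ ternary j = 1 ∨ ternary j = 2 := by
  generalize ternary j = a
  revert a
  decide

theorem cut_of_zero {j : ℕ} (h : ternary j = 0) :
    cut (j + 1) = cut j + 2 ∧ ternary (cut j) = 0 ∧ ternary (cut j + 1) = 1 := by
  have h0 := isConcat_ternary.start_succ j
  have h1 := isConcat_ternary.letter j
  simp only [h, subst] at h0 h1
  have h2 := h1 0
  have h3 := h1 1
  simp at h0 h2 h3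
  exact ⟨h0, h2.symm, h3.symm⟩

theorem cut_of_one {j : ℕ} (h : ternary j = 1) :
    cut (j + 1) = cut j + 2 ∧ ternary (cut j) = 2 ∧ ternary (cut j + 1) = 1 := by
  have h0 := isConcat_ternary.start_succ j
  have h1 := isConcat_ternary.letter j
  simp only [h, subst] at h0 h1
  have h2 := h1 0
  have h3 := h1 1
  simp at h0 h2 h3
  exact ⟨h0, h2.symm, h3.symm⟩

theorem cut_of_two {j : ℕ} (h : ternary j = 2) :
    cut (j + 1) = cut j + 1 ∧ ternary (cut j) = 0 := by
  have h0 := isConcat_ternary.start_succ j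
  have h1 := isConcat_ternary.letter j
  simp only [h, subst] at h0 h1
  have h2 := h1 0
  simp at h0 h2
  exact ⟨h0, h2.symm⟩

theorem codeCut_of_zero {j : ℕ} (h : ternary j = 0) :
    codeCut (j + 1) = codeCut j + 6 ∧ binary (codeCut j) = false ∧
      binary (codeCut j + 1) = true ∧ binary (codeCut j + 2) = true ∧
      binary (codeCut j + 3) = false ∧ binary (codeCut j + 4) = false ∧
      binary (codeCut j + 5) = true := by
  have h0 := isConcat_binary.start_succ j
  have h1 := isConcat_binary.letter j
  simp only [h, code] at h0 h1
  have h2 := h1 0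
  have h3 := h1 1
  have h4 := h1 2
  have h5 := h1 3
  have h6 := h1 4
  have h7 := h1 5
  simp at h0 h2 h3 h4 h5 h6 h7
  exact ⟨h0, h2, h3, h4, h5, h6, h7⟩

theorem codeCut_of_one {j : ℕ} (h : ternary j = 1) :
    codeCut (j + 1) = codeCut j + 1 ∧ binary (codeCut j) = false := by
  have h0 := isConcat_binary.start_succ j
  have h1 := isConcat_binary.letter j
  simp only [h, code] at h0 h1
  have h2 := h1 0
  simp at h0 h2
  exact ⟨h0, h2⟩

theorem codeCut_of_two {j : ℕ} (h : ternary j = 2) :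
    codeCut (j + 1) = codeCut j + 5 ∧ binary (codeCut j) = false ∧
      binary (codeCut j + 1) = true ∧ binary (codeCut j + 2) = true ∧
      binary (codeCut j + 3) = false ∧ binary (codeCut j + 4) = true := by
  have h0 := isConcat_binary.start_succ j
  have h1 := isConcat_binary.letter j
  simp only [h, code] at h0 h1
  have h2 := h1 0
  have h3 := h1 1
  have h4 := h1 2
  have h5 := h1 3
  have h6 := h1 4
  simp at h0 h2 h3 h4 h5 h6
  exact ⟨h0, h2, h3, h4, h5, h6⟩

/-! ### Local structure of the fixed point -/

theorem cut_zero : cut 0 = 0 := rfl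

theorem cut_strictMono : StrictMono cut := isConcat_ternary.start_strictMono

theorem cut_lt_cut_succ (n : ℕ) : cut n < cut (n + 1) := cut_strictMono (Nat.lt_succ_self n)

theorem lt_cut {n : ℕ} (hn : 1 ≤ n) : n < cut n := by
  induction n, hn using Nat.le_induction with
  | base => decide
  | succ n _ ih => have := cut_lt_cut_succ n; omega

theorem ternary_cut_ne_one (j : ℕ) : ternary (cut j) ≠ 1 := by
  rcases ternary_cases j with h | h | h
  · simp [(cut_of_zero h).2.1]
  · simp [(cut_of_one h).2.1]
  · simp [(cut_of_two h).2]

theorem exists_cut_or (n : ℕ) :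
    ∃ j, cut j = n ∨ (cut (j + 1) = n + 1 ∧ cut j + 1 = n ∧ ternary n = 1) := by
  obtain ⟨j, h1, h2⟩ := isConcat_ternary.exists_block n
  refine ⟨j, ?_⟩
  by_cases h : cut j = n
  · exact Or.inl h
  refine Or.inr ?_
  rcases ternary_cases j with h0 | h0 | h0
  · obtain ⟨h3, -, h4⟩ := cut_of_zero h0
    have : cut j + 1 = n := by omega
    exact ⟨by omega, this, this ▸ h4⟩
  · obtain ⟨h3, -, h4⟩ := cut_of_one h0
    have : cut j + 1 = n := by omega
    exact ⟨by omega, this, this ▸ h4⟩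
  · have := (cut_of_two h0).1
    omega

theorem exists_cut_of_ne_one {n : ℕ} (h : ternary n ≠ 1) : ∃ j, cut j = n := by
  obtain ⟨j, hj | hj⟩ := exists_cut_or n
  · exact ⟨j, hj⟩
  · exact absurd hj.2.2 h

theorem exists_cut_of_eq_one {n : ℕ} (h : ternary n = 1) : ∃ j, cut j = n + 1 := by
  obtain ⟨j, hj | hj⟩ := exists_cut_or n
  · exact absurd (hj ▸ h) (ternary_cut_ne_one j)
  · exact ⟨j + 1, hj.1⟩

/-- The ordered pairs of letters that can be adjacent in `ternary`. -/
def adjacentPairs : List (Fin 3 × Fin 3) := [(0, 1), (0, 2), (1, 0), (1, 2), (2, 1)]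

theorem adjacent_mem (n : ℕ) : (ternary n, ternary (n + 1)) ∈ adjacentPairs := by
  induction n using Nat.strong_induction_on with
  | _ n ih =>
    obtain ⟨j, rfl | ⟨h1, h2, h3⟩⟩ := exists_cut_or n
    · rcases ternary_cases j with h | h | h
      · simp [(cut_of_zero h).2, adjacentPairs]
      · simp [(cut_of_one h).2, adjacentPairs]
      · have hj : j ≠ 0 := by rintro rfl; exact absurd h (by decide)
        have h1 := ih j (lt_cut (by omega))
        have h2 := cut_of_two h
        have h3 : ternary (j + 1) = 1 := by simpa [h, adjacentPairs] using h1
        rw [h2.2, ← h2.1, (cut_of_one h3).2.1]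
        decide
    · rw [← h1, h3]
      rcases ternary_cases (j + 1) with h | h | h
      · simp [(cut_of_zero h).2.1, adjacentPairs]
      · simp [(cut_of_one h).2.1, adjacentPairs]
      · simp [(cut_of_two h).2, adjacentPairs]

theorem ternary_succ_of_two {n : ℕ} (h : ternary n = 2) : ternary (n + 1) = 1 := by
  simpa [h, adjacentPairs] using adjacent_mem n

theorem ternary_pred_of_two {n : ℕ} (h : ternary (n + 1) = 2) : ternary n ≠ 2 := by
  intro h'
  simp [ternary_succ_of_two h'] at h

/-- Additive functions of the prefixes of `ternary` agree on the two occurrences of a repeated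
block. -/
theorem additive_shift {F : ℕ → ℕ} {φ : Fin 3 → ℕ} (hF : ∀ n, F (n + 1) = F n + φ (ternary n))
    {s f q : ℕ} (heq : ∀ j, s ≤ j → j < f → ternary j = ternary (j + q)) {i j : ℕ}
    (hi : s ≤ i) (hij : i ≤ j) (hj : j ≤ f) : F (j + q) + F i = F j + F (i + q) := by
  induction j, hij using Nat.le_induction with
  | base => omega
  | succ j hij ih =>
    have h1 := ih (by omega)
    have h2 := hF j
    have h3 := hF (j + q)
    rw [← heq j (by omega) (by omega)] at h3
    rw [show j + 1 + q = j + q + 1 by omega]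
    omega

theorem cut_succ (n : ℕ) : cut (n + 1) = cut n + (subst (ternary n)).length :=
  isConcat_ternary.start_succ n

theorem codeCut_succ (n : ℕ) : codeCut (n + 1) = codeCut n + (code (ternary n)).length :=
  isConcat_binary.start_succ n

/-- A letter is determined by the two letters at the start of its image. -/
theorem ternary_eq_of_cut_eq {i j : ℕ} (h0 : ternary (cut i) = ternary (cut j))
    (h1 : ternary (cut i + 1) = ternary (cut j + 1)) : ternary i = ternary j := by
  have key : ∀ i, ternary i = 2 → ternary (cut i + 1) = 2 := by
    intro i hi
    rw [← (cut_of_two hi).1, (cut_of_one (ternary_succ_of_two hi)).2.1]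
  rcases ternary_cases i with hi | hi | hi <;> rcases ternary_cases j with hj | hj | hj <;>
    first
    | exact hi.trans hj.symm
    | (exfalso
       simp_all [cut_of_zero, cut_of_one, cut_of_two])

theorem not_eventually_periodic (q : ℕ) (hq : 1 ≤ q) (i : ℕ) :
    ∃ j, i ≤ j ∧ ternary j ≠ ternary (j + q) := by
  induction q using Nat.strong_induction_on generalizing i with
  | _ q ih =>
    by_contra! hper
    obtain ⟨a, ha, ha2⟩ : ∃ a, i + 1 ≤ a ∧ ternary a ≠ 2 := by
      by_cases h : ternary (i + 1) = 2
      · exact ⟨i + 2, by omega, by simp [ternary_succ_of_two h]⟩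
      · exact ⟨i + 1, le_rfl, h⟩
    have hia : i ≤ cut a := by have := lt_cut (n := a) (by omega); omega
    obtain ⟨b, hb⟩ := exists_cut_of_ne_one (hper _ hia ▸ ternary_cut_ne_one a)
    have hab : a < b := cut_strictMono.lt_iff_lt.1 (by omega)
    have key : ∀ d, cut (b + d) = cut (a + d) + q ∧ ternary (a + d) = ternary (b + d) := by
      intro d
      induction d with
      | zero =>
        refine ⟨hb, ternary_eq_of_cut_eq ?_ ?_⟩
        · simpa [hb] using hper _ hia
        · have := hper (cut a + 1) (by omega)
          rw [add_zero, add_zero, hb, this]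
          congr 1
          omega
      | succ d ihd =>
        have h1 := cut_succ (a + d)
        have h2 := cut_succ (b + d)
        rw [ihd.2] at h1
        have h3 : cut (b + (d + 1)) = cut (a + (d + 1)) + q := by
          rw [← add_assoc, ← add_assoc]
          omega
        have h4 : i ≤ cut (a + (d + 1)) := hia.trans (cut_strictMono.monotone (by omega))
        refine ⟨h3, ternary_eq_of_cut_eq ?_ ?_⟩
        · rw [h3]; exact hper _ h4
        · rw [h3, hper _ (by omega)]
          congr 1
          omega
    have hlt : b - a < q := by
      have h1 : ∀ d, cut (a + 1) + d ≤ cut (a + 1 + d) := by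
        intro d
        induction d with
        | zero => simp
        | succ d ihd =>
          have := cut_lt_cut_succ (a + 1 + d)
          rw [← add_assoc (a + 1) d 1]
          omega
      have h2 := h1 (b - a - 1)
      rw [show a + 1 + (b - a - 1) = b by omega] at h2
      have h3 : cut (a + 1) = cut a + 2 := by
        rcases ternary_cases a with h | h | h
        · exact (cut_of_zero h).1
        · exact (cut_of_one h).1
        · exact absurd h ha2
      omega
    obtain ⟨j, hj, hne⟩ := ih (b - a) hlt (by omega) a
    apply hne
    have := (key (j - a)).2
    rwa [show a + (j - a) = j by omega, show b + (j - a) = j + (b - a) by omega] at this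

/-! ### Maximal runs and desubstitution -/

/-- `[i, e)` is a maximal interval on which `ternary` agrees with its shift by `q`. -/
structure MaxRun (i e q : ℕ) : Prop where
  pos : 1 ≤ q
  le : i ≤ e
  eq : ∀ j, i ≤ j → j < e → ternary j = ternary (j + q)
  ne_right : ternary e ≠ ternary (e + q)
  ne_left : ∀ j, j + 1 = i → ternary j ≠ ternary (j + q)

theorem exists_maxRun (a : ℕ) {q : ℕ} (hq : 1 ≤ q) :
    ∃ s f, s ≤ a ∧ a ≤ f ∧ MaxRun s f q := by
  classical
  have hr := not_eventually_periodic q hq a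
  have hl : ∃ s, ∀ j, s ≤ j → j < a → ternary j = ternary (j + q) := ⟨a, by omega⟩
  have hs : Nat.find hl ≤ a := Nat.find_min' hl (by omega)
  have hf := Nat.find_spec hr
  refine ⟨Nat.find hl, Nat.find hr, hs, hf.1, hq, hs.trans hf.1, ?_, hf.2, ?_⟩
  · intro j h1 h2
    by_cases h : j < a
    · exact Nat.find_spec hl j h1 h
    · have := Nat.find_min hr h2
      push Not at this
      exact this (by omega)
  · intro j hj h
    refine Nat.find_min hl (m := j) (by omega) fun j' h1 h2 => ?_
    rcases eq_or_lt_of_le h1 with rfl | h3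
    · exact h
    · exact Nat.find_spec hl j' (by omega) h2

theorem MaxRun.unique {i e i' e' q : ℕ} (h : MaxRun i e q) (h' : MaxRun i' e' q)
    (h1 : i ≤ e') (h2 : i' ≤ e) : i = i' ∧ e = e' := by
  have he : e = e' := by
    rcases lt_trichotomy e e' with hlt | rfl | hlt
    · exact absurd (h'.eq e h2 hlt) h.ne_right
    · rfl
    · exact absurd (h.eq e' h1 hlt) h'.ne_right
  have := h.le
  have := h'.le
  refine ⟨?_, he⟩
  rcases lt_trichotomy i i' with hlt | rfl | hlt
  · exact absurd (h.eq (i' - 1) (by omega) (by omega)) (h'.ne_left (i' - 1) (by omega))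
  · rfl
  · exact absurd (h'.eq (i - 1) (by omega) (by omega)) (h.ne_left (i - 1) (by omega))

/-- The length of `code (subst^k a)`. -/
def len : ℕ → Fin 3 → ℕ
  | 0, a => (code a).length
  | k + 1, a => ((subst a).map (len k)).sum

theorem len_succ_zero (k : ℕ) : len (k + 1) 0 = len k 0 + len k 1 := by simp [len, subst]
theorem len_succ_one (k : ℕ) : len (k + 1) 1 = len k 2 + len k 1 := by simp [len, subst]
theorem len_succ_two (k : ℕ) : len (k + 1) 2 = len k 0 := by simp [len, subst]

/-- The length of `code (subst^k u)`, where `u` is the prefix of `ternary` of length `n`. -/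
def prefixLen (k n : ℕ) : ℕ := ∑ j ∈ Finset.range n, len k (ternary j)

theorem prefixLen_add_one (k n : ℕ) : prefixLen k (n + 1) = prefixLen k n + len k (ternary n) :=
  Finset.sum_range_succ _ _

theorem prefixLen_level_succ (k n : ℕ) : prefixLen (k + 1) n = prefixLen k (cut n) := by
  induction n with
  | zero => rfl
  | succ n ih =>
    rw [prefixLen_add_one, ih]
    rcases ternary_cases n with h | h | h
    · obtain ⟨h1, h2, h3⟩ := cut_of_zero h
      rw [h1, prefixLen_add_one, prefixLen_add_one, h, h2, h3, len_succ_zero, add_assoc]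
    · obtain ⟨h1, h2, h3⟩ := cut_of_one h
      rw [h1, prefixLen_add_one, prefixLen_add_one, h, h2, h3, len_succ_one, add_assoc]
    · obtain ⟨h1, h2⟩ := cut_of_two h
      rw [h1, prefixLen_add_one, h, h2, len_succ_two]

theorem prefixLen_level_zero (n : ℕ) : prefixLen 0 n = codeCut n := by
  induction n with
  | zero => rfl
  | succ n ih => rw [prefixLen_add_one, ih, codeCut_succ, len]

/-- How far a run extends to the left under `code ∘ subst^k`. The mismatching letters preceding
the run are recorded by their sum; `0` stands for a run without preceding letter. -/
def leftExt : ℕ → ℕ → ℕ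
  | 0, m => if m = 2 then 2 else 0
  | k + 1, m => if m = 0 then 0 else if m = 1 then len k 1 + leftExt k 2 else leftExt k 1

/-- How far a run extends to the right under `code ∘ subst^k`. The mismatching letters following
the run are recorded by their sum. -/
def rightExt : ℕ → ℕ → ℕ
  | 0, m => if m = 2 then 4 else 1
  | k + 1, m => if m = 2 then len k 0 + rightExt k 3 else rightExt k 2

/-- The sum of the two mismatching letters preceding a run. -/
def leftType : ℕ → ℕ → ℕ
  | 0, _ => 0
  | i + 1, q => (ternary i).val + (ternary (i + q)).val

/-- The sum of the two mismatching letters following a run. -/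
def rightType (e q : ℕ) : ℕ := (ternary e).val + (ternary (e + q)).val

theorem leftExt_zero_type (k : ℕ) : leftExt k 0 = 0 := by cases k <;> rfl

theorem image_mismatch_right {f f' : ℕ} (h : ternary f ≠ ternary f') :
    ∃ δ, (∀ r < δ, ternary (cut f + r) = ternary (cut f' + r)) ∧
      ternary (cut f + δ) ≠ ternary (cut f' + δ) ∧
      ∀ k, rightExt (k + 1) ((ternary f).val + (ternary f').val) + prefixLen k (cut f) =
        rightExt k ((ternary (cut f + δ)).val + (ternary (cut f' + δ)).val) +
          prefixLen k (cut f + δ) := by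
  have key : ∀ i, ternary i = 2 → ternary (cut i + 1) = 2 := by
    intro i hi
    rw [← (cut_of_two hi).1, (cut_of_one (ternary_succ_of_two hi)).2.1]
  rcases ternary_cases f with hf | hf | hf <;> rcases ternary_cases f' with hf' | hf' | hf' <;>
    first
    | exact absurd (hf.trans hf'.symm) h
    | (refine ⟨0, by simp, ?_, ?_⟩ <;>
        (simp [hf, hf', cut_of_zero, cut_of_one, cut_of_two, rightExt]; done))
    | (refine ⟨1, ?_, ?_, ?_⟩ <;>
        simp [hf, hf', cut_of_zero, cut_of_two, key, rightExt, prefixLen_add_one] <;> omega)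

theorem image_mismatch_left {s s' : ℕ} (h : ternary s ≠ ternary s') :
    ∃ δ x y, cut (s + 1) = x + 1 + δ ∧ cut (s' + 1) = y + 1 + δ ∧
      (∀ r < δ, ternary (x + 1 + r) = ternary (y + 1 + r)) ∧ ternary x ≠ ternary y ∧
      ∀ k, leftExt (k + 1) ((ternary s).val + (ternary s').val) + prefixLen k (x + 1) =
          leftExt k ((ternary x).val + (ternary y).val) + prefixLen k (cut (s + 1)) := by
  rcases ternary_cases s with hs | hs | hs <;> rcases ternary_cases s' with hs' | hs' | hs' <;>
    first
    | exact absurd (hs.trans hs'.symm) h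
    | (refine ⟨1, cut s, cut s', ?_, ?_, ?_, ?_, ?_⟩ <;>
        simp [hs, hs', cut_of_zero, cut_of_one, leftExt, prefixLen_add_one] <;> omega)
    | (refine ⟨0, cut s + 1, cut s', ?_, ?_, ?_, ?_, ?_⟩ <;>
        (simp [hs, hs', cut_of_zero, cut_of_one, cut_of_two, leftExt]; done))
    | (refine ⟨0, cut s, cut s' + 1, ?_, ?_, ?_, ?_, ?_⟩ <;>
        simp [hs, hs', cut_of_zero, cut_of_one, cut_of_two, leftExt])

theorem MaxRun.cut_add {s f q j : ℕ} (h : MaxRun s f q) (h1 : s ≤ j) (h2 : j ≤ f) :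
    cut (j + q) + cut s = cut j + cut (s + q) :=
  additive_shift (φ := fun a => (subst a).length) cut_succ h.eq le_rfl h1 h2

theorem MaxRun.image {s f q : ℕ} (h : MaxRun s f q) :
    ∃ i e, MaxRun i e (cut (s + q) - cut s) ∧ i ≤ cut s ∧ cut f ≤ e ∧
      (∀ k, leftExt (k + 1) (leftType s q) + prefixLen k i =
        leftExt k (leftType i (cut (s + q) - cut s)) + prefixLen k (cut s)) ∧
      ∀ k, rightExt (k + 1) (rightType f q) + prefixLen k (cut f) =
        rightExt k (rightType e (cut (s + q) - cut s)) + prefixLen k e := by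
  have hpos := h.pos
  have hlt : cut s < cut (s + q) := cut_strictMono (by omega)
  have hshift : ∀ j, s ≤ j → j ≤ f → cut (j + q) = cut j + (cut (s + q) - cut s) := by
    intro j h1 h2
    have := h.cut_add h1 h2
    omega
  generalize hp : cut (s + q) - cut s = p at hshift ⊢
  have hmid : ∀ u, cut s ≤ u → u < cut f → ternary u = ternary (u + p) := by
    intro u h1 h2
    obtain ⟨j, h3, h4⟩ := isConcat_ternary.exists_block u
    have hsj : s ≤ j := by
      have := cut_strictMono.lt_iff_lt.1 (h1.trans_lt h4)
      omega
    have hjf : j < f := cut_strictMono.lt_iff_lt.1 (h3.trans_lt h2)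
    have h5 := hshift j hsj hjf.le
    have h6 := isConcat_ternary.letter j (u - cut j)
    have h7 := isConcat_ternary.letter (j + q) (u - cut j)
    have h8 := cut_succ j
    rw [← h.eq j hsj hjf] at h7
    rw [h6 (by omega)] at h7
    have h9 := Option.some.inj (h7 (by omega))
    rwa [h5, show cut j + (u - cut j) = u by omega,
      show cut j + p + (u - cut j) = u + p by omega] at h9
  obtain ⟨δ, hr1, hr2, hr3⟩ := image_mismatch_right h.ne_right
  rw [hshift f h.le le_rfl] at hr1 hr2 hr3
  have hright : ∀ u, cut s ≤ u → u < cut f + δ → ternary u = ternary (u + p) := by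
    intro u h1 h2
    by_cases h3 : u < cut f
    · exact hmid u h1 h3
    · have := hr1 (u - cut f) (by omega)
      rwa [show cut f + (u - cut f) = u by omega,
        show cut f + p + (u - cut f) = u + p by omega] at this
  have hsf : cut s ≤ cut f := cut_strictMono.monotone h.le
  have hcomm : cut f + p + δ = cut f + δ + p := by omega
  rw [hcomm] at hr2
  simp only [hcomm] at hr3
  rcases s with _ | s
  · refine ⟨0, cut f + δ, ⟨by omega, by omega, fun u _ => hright u (by simp [cut_zero]), hr2,
      by omega⟩, by omega, by omega, ?_, hr3⟩
    intro k
    simp [leftType, leftExt_zero_type, cut_zero]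
  · obtain ⟨ε, x, y, h1, h2, h3, h4, h5⟩ := image_mismatch_left (h.ne_left s rfl)
    have h6 := hshift (s + 1) le_rfl h.le
    rw [show s + q + 1 = s + 1 + q by omega] at h2
    obtain rfl : y = x + p := by omega
    refine ⟨x + 1, cut f + δ, ⟨by omega, by omega, ?_, hr2, ?_⟩, by omega, by omega, h5, hr3⟩
    · intro u h7 h8
      by_cases h9 : u < cut (s + 1)
      · have := h3 (u - (x + 1)) (by omega)
        rwa [show x + 1 + (u - (x + 1)) = u by omega,
          show x + p + 1 + (u - (x + 1)) = u + p by omega] at this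
      · exact hright u (by omega) h8
    · intro j hj
      obtain rfl : j = x := by omega
      exact h4

/-- A nonempty maximal run is the image of a maximal run that ends earlier. -/
theorem MaxRun.exists_preimage {i e q : ℕ} (h : MaxRun i e q) (hie : i < e) :
    ∃ s f p, MaxRun s f p ∧ f + p < e + q ∧ ∀ k,
      prefixLen (k + 1) f + leftExt (k + 1) (leftType s p) + rightExt (k + 1) (rightType f p) +
          prefixLen k i =
        prefixLen k e + leftExt k (leftType i q) + rightExt k (rightType e q) +
          prefixLen (k + 1) s ∧
      prefixLen (k + 1) (s + p) + prefixLen k i = prefixLen k (i + q) + prefixLen (k + 1) s := by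
  have hpos := h.pos
  obtain ⟨c, a, b, hic, hce, ha, hb⟩ : ∃ c a b, i ≤ c ∧ c ≤ e ∧ cut a = c ∧ cut b = c + q := by
    by_cases h1 : ternary i = 1
    · obtain ⟨a, ha⟩ := exists_cut_of_eq_one h1
      obtain ⟨b, hb⟩ := exists_cut_of_eq_one (h.eq i le_rfl hie ▸ h1)
      exact ⟨i + 1, a, b, by omega, by omega, ha, by omega⟩
    · obtain ⟨a, ha⟩ := exists_cut_of_ne_one h1
      obtain ⟨b, hb⟩ := exists_cut_of_ne_one (h.eq i le_rfl hie ▸ h1)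
      exact ⟨i, a, b, by omega, by omega, ha, by omega⟩
  have hab : a < b := cut_strictMono.lt_iff_lt.1 (by omega)
  obtain ⟨s, f, hsa, haf, hrun⟩ := exists_maxRun a (q := b - a) (by omega)
  have hq : cut (s + (b - a)) - cut s = q := by
    have := hrun.cut_add hsa haf
    rw [show a + (b - a) = b by omega] at this
    omega
  obtain ⟨i', e', himg, h1, h2, h3, h4⟩ := hrun.image
  rw [hq] at himg h3 h4
  have h5 := cut_strictMono.monotone hsa
  have h6 := cut_strictMono.monotone haf
  obtain ⟨rfl, rfl⟩ := h.unique himg (by omega) (by omega)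
  have hsf := cut_strictMono.monotone hrun.le
  have hfq := hrun.cut_add hrun.le le_rfl
  have hlt : cut s < cut (s + (b - a)) := cut_strictMono (by omega)
  refine ⟨s, f, b - a, hrun, ?_, fun k => ⟨?_, ?_⟩⟩
  · have := lt_cut (n := f + (b - a)) (by omega)
    omega
  · have := h3 k
    have := h4 k
    rw [prefixLen_level_succ, prefixLen_level_succ]
    omega
  · rw [prefixLen_level_succ, prefixLen_level_succ, show cut (s + (b - a)) = cut s + q by omega]
    rw [additive_shift (prefixLen_add_one k) h.eq le_rfl h1 (hsf.trans h2), add_comm]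

theorem len_zero_le (k : ℕ) : len k 0 ≤ len k 1 + len k 2 := by
  cases k with
  | zero => decide
  | succ k => rw [len_succ_zero, len_succ_one, len_succ_two]; omega

theorem rightExt_three_le (k : ℕ) : rightExt k 3 ≤ rightExt k 2 ∧
    rightExt k 2 ≤ len k 0 + rightExt k 3 := by
  induction k with
  | zero => decide
  | succ k ih => simp [rightExt, len_succ_zero]; omega

theorem rightExt_le (k : ℕ) {m : ℕ} : rightExt k m ≤ rightExt k 2 := by
  have := (rightExt_three_le k).1
  cases k with
  | zero => simp [rightExt]; split_ifs <;> omega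
  | succ k =>
    by_cases hm : m = 2
    · rw [hm]
    · simpa [rightExt, hm] using this

theorem leftExt_one_le (k : ℕ) : leftExt k 1 ≤ len k 1 + leftExt k 2 ∧
    leftExt k 2 ≤ leftExt k 1 + len k 2 := by
  induction k with
  | zero => decide
  | succ k ih => simp [leftExt, len_succ_one, len_succ_two]; omega

theorem leftExt_le (k : ℕ) {m : ℕ} (hm : m ≠ 2 ∨ k ≠ 0) : leftExt k m ≤ leftExt k 1 := by
  cases k with
  | zero =>
    have : m ≠ 2 := by omega
    simp [leftExt, this]
  | succ k =>
    have := (leftExt_one_le k).1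
    simp only [leftExt]
    split_ifs <;> simp_all

/-- The bound on the extensions of an empty maximal run follows from its two critical instances. -/
theorem MaxRun.ext_le_of_empty {γ : ℝ} (hγ : 1 ≤ γ)
    (h0 : ∀ k, (leftExt k 1 + rightExt k 2 : ℝ) ≤ γ * len k 0)
    (h1 : ∀ k, (leftExt k 1 + rightExt k 3 : ℝ) ≤ γ * len k 1)
    {i q : ℕ} (h : MaxRun i i q) (k : ℕ) :
    (leftExt k (leftType i q) + rightExt k (rightType i q) : ℝ) ≤
      γ * (prefixLen k (i + q) - prefixLen k i) := by
  have hmono : Monotone (prefixLen k) :=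
    monotone_nat_of_le_succ fun n => by rw [prefixLen_add_one]; omega
  have hbig : ∀ n : ℕ, len k 0 ≤ n →
      (leftExt k (leftType i q) + rightExt k (rightType i q) : ℝ) ≤ γ * n := by
    intro n hn
    have hn' : (len k 0 : ℝ) ≤ n := by exact_mod_cast hn
    have h2 : rightExt k (rightType i q) ≤ rightExt k 2 := rightExt_le k
    by_cases hk : leftType i q ≠ 2 ∨ k ≠ 0
    · have h3 := leftExt_le k hk
      have h4 : (leftExt k (leftType i q) + rightExt k (rightType i q) : ℝ) ≤
          leftExt k 1 + rightExt k 2 := by exact_mod_cast add_le_add h3 h2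
      nlinarith [h0 k]
    · push Not at hk
      obtain ⟨hk1, rfl⟩ := hk
      have h4 : leftExt 0 2 + rightExt 0 (rightType i q) ≤ len 0 0 :=
        (add_le_add_right h2 _).trans (by decide)
      have h5 : (leftExt 0 2 + rightExt 0 (rightType i q) : ℝ) ≤ len 0 0 := by exact_mod_cast h4
      rw [hk1]
      nlinarith
  have hcast : ((prefixLen k (i + q) : ℝ) - prefixLen k i) =
      ((prefixLen k (i + q) - prefixLen k i : ℕ) : ℝ) := by
    rw [Nat.cast_sub (hmono (by omega))]
  have hpos := h.pos
  by_cases hz : ∃ j, i ≤ j ∧ j < i + q ∧ ternary j = 0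
  · obtain ⟨j, hj1, hj2, hj3⟩ := hz
    rw [hcast]
    apply hbig
    have h2 := hmono hj1
    have h3 : prefixLen k (j + 1) ≤ prefixLen k (i + q) := hmono (by omega)
    rw [prefixLen_add_one, hj3] at h3
    omega
  push Not at hz
  have hi0 := hz i le_rfl (by omega)
  by_cases hq : 2 ≤ q
  · rw [hcast]
    apply hbig
    have h3 : prefixLen k (i + 1 + 1) ≤ prefixLen k (i + q) := hmono (by omega)
    have h4 := hz (i + 1) (by omega) (by omega)
    have h5 := adjacent_mem i
    have h6 := len_zero_le k
    rw [prefixLen_add_one, prefixLen_add_one] at h3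
    rcases ternary_cases i with h7 | h7 | h7
    · exact absurd h7 hi0
    · have h8 : ternary (i + 1) = 2 := by simpa [h7, adjacentPairs, h4] using h5
      rw [h7, h8] at h3
      omega
    · have h8 := ternary_succ_of_two h7
      rw [h7, h8] at h3
      omega
  obtain rfl : q = 1 := by omega
  rw [prefixLen_add_one]
  push_cast
  rw [add_sub_cancel_left]
  have hr := h.ne_right
  rcases ternary_cases i with h7 | h7 | h7
  · exact absurd h7 hi0
  · have hR : rightExt k (rightType i 1) = rightExt k 3 := by
      rw [rightType, h7]
      rcases ternary_cases (i + 1) with h8 | h8 | h8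
      · rw [h8]; cases k <;> rfl
      · exact absurd (h7.trans h8.symm) hr
      · rw [h8]; rfl
    have hL : leftType i 1 ≠ 2 := by
      rcases i with _ | i
      · simp [leftType]
      · have h9 := h.ne_left i rfl
        rcases ternary_cases i with h8 | h8 | h8 <;> simp_all [leftType]
    rw [h7, hR]
    have h9 : (leftExt k (leftType i 1) : ℝ) ≤ leftExt k 1 := by
      exact_mod_cast leftExt_le k (Or.inl hL)
    linarith [h1 k]
  · have h8 := ternary_succ_of_two h7
    have hR : rightType i 1 = 3 := by rw [rightType, h7, h8]; rfl
    have hL : leftType i 1 = 2 ∨ leftType i 1 = 3 := by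
      rcases i with _ | i
      · exact absurd h7 (by decide)
      · rcases ternary_cases i with h11 | h11 | h11
        · exact Or.inl (by rw [leftType, h11, h7]; rfl)
        · exact Or.inr (by rw [leftType, h11, h7]; rfl)
        · exact absurd h11 (ternary_pred_of_two h7)
    rw [hR, h7]
    cases k with
    | zero =>
      rcases hL with hL | hL <;> rw [hL] <;> norm_num [leftExt, rightExt, len, code] <;> linarith
    | succ k =>
      rcases hL with hL | hL <;> rw [hL] <;> simpa [leftExt, rightExt, len_succ_two] using h0 k

/-- Upper bound for the maximal runs of all the words `code (subst^k (ternary))`. -/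
theorem MaxRun.bound {γ : ℝ} (hγ : 1 ≤ γ)
    (h0 : ∀ k, (leftExt k 1 + rightExt k 2 : ℝ) ≤ γ * len k 0)
    (h1 : ∀ k, (leftExt k 1 + rightExt k 3 : ℝ) ≤ γ * len k 1)
    {i e q : ℕ} (h : MaxRun i e q) (k : ℕ) :
    (prefixLen k e + leftExt k (leftType i q) + rightExt k (rightType e q) - prefixLen k i : ℝ) ≤
      γ * (prefixLen k (i + q) - prefixLen k i) := by
  induction hN : e + q using Nat.strong_induction_on generalizing i e q k with
  | _ N ih =>
    rcases h.le.eq_or_lt with rfl | hie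
    · have := h.ext_le_of_empty hγ h0 h1 k
      linarith
    · obtain ⟨s, f, p, hrun, hlt, hk⟩ := h.exists_preimage hie
      have h2 := ih (f + p) (by omega) hrun (k + 1) rfl
      obtain ⟨h3, h4⟩ := hk k
      have h3' : (prefixLen (k + 1) f + leftExt (k + 1) (leftType s p) +
          rightExt (k + 1) (rightType f p) + prefixLen k i : ℝ) =
        prefixLen k e + leftExt k (leftType i q) + rightExt k (rightType e q) +
          prefixLen (k + 1) s := by exact_mod_cast h3
      have h4' : (prefixLen (k + 1) (s + p) + prefixLen k i : ℝ) =
          prefixLen k (i + q) + prefixLen (k + 1) s := by exact_mod_cast h4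
      have h5 : (prefixLen (k + 1) (s + p) - prefixLen (k + 1) s : ℝ) =
          prefixLen k (i + q) - prefixLen k i := by linarith
      rw [h5] at h2
      linarith

/-! ### The critical inequalities -/

theorem exists_root : ∃ β : ℝ, β ^ 3 - 2 * β ^ 2 + β - 1 = 0 ∧ 1.7548 < β ∧ β < 1.7549 := by
  have hc : ContinuousOn (fun t : ℝ => t ^ 3 - 2 * t ^ 2 + t - 1) (Set.Icc 1.7548 1.7549) := by
    fun_prop
  obtain ⟨β, hβ, h0⟩ := intermediate_value_Ioo (by norm_num) hc
    (show (0 : ℝ) ∈ Set.Ioo _ _ by constructor <;> norm_num)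
  exact ⟨β, h0, hβ.1, hβ.2⟩

theorem root_unique {β t : ℝ} (hβ : β ^ 3 - 2 * β ^ 2 + β - 1 = 0) (h1 : 1.7548 < β)
    (ht : t ^ 3 - 2 * t ^ 2 + t - 1 = 0) : t = β := by
  have h2 : (t - β) * (t ^ 2 + (β - 2) * t + (β - 1) ^ 2) = 0 := by linear_combination ht - hβ
  rcases mul_eq_zero.1 h2 with h | h
  · linarith
  · nlinarith [sq_nonneg (2 * t + (β - 2))]

theorem inv_sq_sub_one {β : ℝ} (hβ : β ^ 3 - 2 * β ^ 2 + β - 1 = 0) (h1 : 1.7548 < β) :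
    1 + 1 / (β ^ 2 - 1) = (2 * β ^ 2 - β + 3) / 5 := by
  have : β ^ 2 - 1 ≠ 0 := by nlinarith
  field_simp
  linear_combination (-2 * β - 3) * hβ

theorem ext_formulas (k : ℕ) :
    (5 * leftExt k 1 + len k 2 + 14 = 3 * len k 0 + len k 1 ∧
      5 * leftExt k 2 + len k 1 + 6 = 2 * len k 0 + len k 2 ∧
      5 * rightExt k 2 + 3 = len k 0 + 2 * len k 1 + 3 * len k 2 ∧
      5 * rightExt k 3 + len k 0 + 2 = 3 * len k 1 + 2 * len k 2) ∨
    (5 * leftExt k 1 + len k 2 + 6 = 3 * len k 0 + len k 1 ∧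
      5 * leftExt k 2 + len k 1 + 14 = 2 * len k 0 + len k 2 ∧
      5 * rightExt k 2 + 2 = len k 0 + 2 * len k 1 + 3 * len k 2 ∧
      5 * rightExt k 3 + len k 0 + 3 = 3 * len k 1 + 2 * len k 2) := by
  induction k with
  | zero => decide
  | succ k ih =>
    simp [leftExt, rightExt, len_succ_zero, len_succ_one, len_succ_two]
    omega

theorem abs_le_of_contraction {β C : ℝ} (h1 : 1.7548 < β) (h2 : β < 1.7549) {h : ℕ → ℝ}
    (hrec : ∀ k, h (k + 2) = (2 - β) * h (k + 1) - (β - 1) ^ 2 * h k)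
    (h0 : |h 0| ≤ C) (h1' : |h 1| ≤ C) (k : ℕ) : |h k| ≤ C := by
  suffices |h k| ≤ C ∧ |h (k + 1)| ≤ C from this.1
  induction k with
  | zero => exact ⟨h0, h1'⟩
  | succ k ih =>
    refine ⟨ih.2, ?_⟩
    have hC : 0 ≤ C := (abs_nonneg _).trans h0
    calc |h (k + 2)| ≤ |(2 - β) * h (k + 1)| + |(β - 1) ^ 2 * h k| := by
          rw [hrec]; exact abs_sub _ _
      _ = (2 - β) * |h (k + 1)| + (β - 1) ^ 2 * |h k| := by
          rw [abs_mul, abs_mul, abs_of_pos (by linarith : 0 < 2 - β),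
            abs_of_nonneg (sq_nonneg (β - 1))]
      _ ≤ (2 - β) * C + (β - 1) ^ 2 * C := by
          gcongr
          · linarith
          · exact ih.2
          · exact ih.1
      _ = (2 - β + (β - 1) ^ 2) * C := by ring
      _ ≤ C := mul_le_of_le_one_left hC (by nlinarith)

theorem len_combination_recurrence {β x y z : ℝ} (hβ : β ^ 3 - 2 * β ^ 2 + β - 1 = 0)
    (hz : β * x + (β ^ 2 - β) * y + z = 0) (k : ℕ) :
    x * len (k + 2) 0 + y * len (k + 2) 1 + z * len (k + 2) 2 =
      (2 - β) * (x * len (k + 1) 0 + y * len (k + 1) 1 + z * len (k + 1) 2) -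
        (β - 1) ^ 2 * (x * len k 0 + y * len k 1 + z * len k 2) := by
  simp only [len_succ_zero, len_succ_one, len_succ_two]
  push_cast
  linear_combination ((β - 1) * len k 0 + len k 1 + (β - 1) ^ 2 * len k 2) * hz
    - (x * len k 2 + y * len k 0 + y * len k 2 * (β - 1)) * hβ

theorem critical_zero {β : ℝ} (hβ : β ^ 3 - 2 * β ^ 2 + β - 1 = 0) (h1 : 1.7548 < β)
    (h2 : β < 1.7549) (k : ℕ) :
    (leftExt k 1 + rightExt k 2 : ℝ) ≤ (2 * β ^ 2 - β + 3) / 5 * len k 0 := by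
  have hext : 5 * (leftExt k 1 + rightExt k 2) + 8 ≤ 4 * len k 0 + 3 * len k 1 + 2 * len k 2 := by
    have := ext_formulas k
    omega
  have hext' : (5 * (leftExt k 1 + rightExt k 2) + 8 : ℝ) ≤
      4 * len k 0 + 3 * len k 1 + 2 * len k 2 := by exact_mod_cast hext
  have hγ : 1.48 < (2 * β ^ 2 - β + 3) / 5 ∧ (2 * β ^ 2 - β + 3) / 5 < 1.482 := by
    constructor <;> nlinarith
  generalize hg : (2 * β ^ 2 - β + 3) / 5 = γ at hγ ⊢
  have hh := abs_le_of_contraction (C := 1.6) h1 h2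
    (h := fun k => (4 / 5 - γ) * len k 0 + 3 / 5 * len k 1 + 2 / 5 * len k 2)
    (len_combination_recurrence hβ (by rw [← hg]; linear_combination (-2 / 5 : ℝ) * hβ))
    (by norm_num [len, code, subst, abs_le]; constructor <;> linarith)
    (by norm_num [len, code, subst, abs_le]; constructor <;> linarith) k
  have := (abs_le.1 hh).2
  linarith

theorem critical_one {β : ℝ} (hβ : β ^ 3 - 2 * β ^ 2 + β - 1 = 0) (h1 : 1.7548 < β)
    (h2 : β < 1.7549) (k : ℕ) :
    (leftExt k 1 + rightExt k 3 : ℝ) ≤ (2 * β ^ 2 - β + 3) / 5 * len k 1 := by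
  have hext : 5 * (leftExt k 1 + rightExt k 3) + 8 ≤ 2 * len k 0 + 4 * len k 1 + len k 2 := by
    have := ext_formulas k
    omega
  have hext' : (5 * (leftExt k 1 + rightExt k 3) + 8 : ℝ) ≤
      2 * len k 0 + 4 * len k 1 + len k 2 := by exact_mod_cast hext
  have hγ : 1.48 < (2 * β ^ 2 - β + 3) / 5 ∧ (2 * β ^ 2 - β + 3) / 5 < 1.482 := by
    constructor <;> nlinarith
  generalize hg : (2 * β ^ 2 - β + 3) / 5 = γ at hγ ⊢
  rcases k with _ | k
  · norm_num [leftExt, rightExt, len, code]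
    linarith
  have hh := abs_le_of_contraction (C := 1.6) h1 h2
    (h := fun k => 2 / 5 * len (k + 1) 0 + (4 / 5 - γ) * len (k + 1) 1 + 1 / 5 * len (k + 1) 2)
    (fun k => len_combination_recurrence hβ
      (by rw [← hg]; linear_combination (-2 / 5 * β - 1 / 5) * hβ) (k + 1))
    (by norm_num [len, code, subst, abs_le]; constructor <;> linarith)
    (by norm_num [len, code, subst, abs_le]; constructor <;> linarith) k
  have := (abs_le.1 hh).2
  linarith

/-! ### Short factors of the binary word -/

/-- The finite word `l` occurs in `x` at position `n`. -/
def OccursAt {α : Type*} (x : ℕ → α) (n : ℕ) (l : List α) : Prop :=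
  ∀ k < l.length, l[k]? = some (x (n + k))

theorem OccursAt.image {α : Type*} {x : ℕ → α} {h : Fin 3 → List α} {c : ℕ → ℕ}
    (hx : IsConcat x (fun j => h (ternary j)) c) {n : ℕ} {l : List (Fin 3)}
    (hl : OccursAt ternary n l) :
    OccursAt x (c n) (l.flatMap h) ∧ c (n + l.length) = c n + (l.flatMap h).length := by
  induction l generalizing n with
  | nil => simp [OccursAt]
  | cons a l ih =>
    have ha : a = ternary n := by simpa using hl 0 (by simp)
    have hl' : OccursAt ternary (n + 1) l := by
      intro k hk
      have := hl (k + 1) (by simpa using hk)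
      rwa [List.getElem?_cons_succ, show n + (k + 1) = n + 1 + k by omega] at this
    obtain ⟨h1, h2⟩ := ih hl'
    have h3 := hx.start_succ n
    subst ha
    refine ⟨?_, ?_⟩
    · intro k hk
      rw [List.flatMap_cons] at hk ⊢
      by_cases hk' : k < (h (ternary n)).length
      · rw [List.getElem?_append_left hk']
        exact hx.letter n k hk'
      · rw [List.getElem?_append_right (by omega), h1 _ (by rw [List.length_append] at hk; omega)]
        congr 2
        omega
    · rw [List.flatMap_cons, List.length_append, List.length_cons,
        show n + (l.length + 1) = n + 1 + l.length by omega, h2, h3]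
      omega

/-- Every position of `x` lies in an occurrence of a word `U a` followed by `U b`, with `a` and `b`
adjacent. -/
def CoveredBy {α : Type*} (x : ℕ → α) (U : Fin 3 → List α) : Prop :=
  ∀ n, ∃ D, ∃ ab ∈ adjacentPairs,
    OccursAt x D (U ab.1 ++ U ab.2) ∧ D ≤ n ∧ n < D + (U ab.1).length

theorem CoveredBy.image {α : Type*} {x : ℕ → α} {h : Fin 3 → List α} {c : ℕ → ℕ}
    (hx : IsConcat x (fun j => h (ternary j)) c) {U : Fin 3 → List (Fin 3)}
    (hU : CoveredBy ternary U) : CoveredBy x fun a => (U a).flatMap h := by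
  intro n
  obtain ⟨j, h1, h2⟩ := hx.exists_block n
  obtain ⟨D, ab, hab, hocc, h3, h4⟩ := hU j
  have hpre : OccursAt ternary D (U ab.1) := by
    intro k hk
    rw [← hocc k (by rw [List.length_append]; omega), List.getElem?_append_left hk]
  have h5 := (OccursAt.image hx hpre).2
  have h6 := hx.start_strictMono.monotone h3
  have h7 := hx.start_strictMono.monotone (show j + 1 ≤ D + (U ab.1).length by omega)
  refine ⟨c D, ab, hab, ?_, by omega, show n < c D + ((U ab.1).flatMap h).length by omega⟩
  rw [← List.flatMap_append]
  exact (OccursAt.image hx hocc).1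

/-- The word `code (subst^3 a)`. -/
def longWord (a : Fin 3) : List Bool :=
  ((([a].flatMap subst).flatMap subst).flatMap subst).flatMap code

theorem coveredBy_longWord : CoveredBy binary longWord := by
  have h : CoveredBy ternary fun a => [a] := by
    intro n
    refine ⟨n, _, adjacent_mem n, ?_, le_rfl, by simp⟩
    intro k hk
    simp only [List.cons_append, List.nil_append, List.length_cons, List.length_nil] at hk
    interval_cases k <;> simp
  exact (((h.image isConcat_ternary).image isConcat_ternary).image isConcat_ternary).image
    isConcat_binary

/-- The factors of length 11 of `binary`. -/
def windows : List (List Bool) :=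
  (adjacentPairs.flatMap fun ab => (List.range (longWord ab.1).length).map fun o =>
    ((longWord ab.1 ++ longWord ab.2).drop o).take 11).dedup

theorem window_mem (n : ℕ) : ((List.range 11).map fun k => binary (n + k)) ∈ windows := by
  obtain ⟨D, ab, hab, hocc, h1, h2⟩ := coveredBy_longWord n
  have hlen : 11 ≤ (longWord ab.2).length := by
    have : ∀ a, 11 ≤ (longWord a).length := by decide +kernel
    exact this _
  simp only [windows, List.mem_dedup, List.mem_flatMap, List.mem_map, List.mem_range]
  refine ⟨ab, hab, n - D, by omega, ?_⟩
  apply List.ext_getElem?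
  intro k
  by_cases hk : k < 11
  · rw [List.getElem?_take_of_lt hk, List.getElem?_drop,
      hocc _ (by rw [List.length_append]; omega)]
    simp [hk, show D + (n - D + k) = n + k by omega]
  · rw [List.getElem?_eq_none (by simp; omega), List.getElem?_eq_none (by simp; omega)]

/-- A prefix of length at most 10 of a window whose complement is a prefix of a window. -/
def commonFactors : List (List Bool) :=
  ((windows.flatMap fun u => (List.range 10).map fun l => u.take (l + 1)).dedup).filter
    fun x => windows.any fun v => v.take x.length == comp x

theorem commonFactors_card : commonFactors.length ≤ 64 := by decide +kernel

theorem comp_window_notMem : ∀ u ∈ windows, comp u ∉ windows := by decide +kernel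

theorem window_double_true :
    ∀ u ∈ windows, ∃ t < 7, u[t]? = some true ∧ u[t + 1]? = some true := by decide +kernel

theorem window_short_period : ∀ u ∈ windows, ∀ qm ∈ [(1, 2), (2, 3), (3, 5), (4, 6)],
    ∃ k < qm.2, u[k]? ≠ u[k + qm.1]? := by decide +kernel

theorem mem_commonFactors {x : List Bool} (hx : x ≠ []) (h1 : FactorN binary x)
    (h2 : FactorN binary (comp x)) : x ∈ commonFactors := by
  obtain ⟨i, hi⟩ := h1
  obtain ⟨j, hj⟩ := h2
  have hlen : (comp x).length = x.length := by simp [comp]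
  rw [hlen] at hj
  have htake : ∀ n l : ℕ, l ≤ 11 → ((List.range 11).map fun k => binary (n + k)).take l =
      (List.range l).map fun k => binary (n + k) := by
    intro n l hl
    rw [← List.map_take, List.take_range, min_eq_left hl]
  have htake' : ∀ n l : ℕ, 11 ≤ l → ((List.range l).map fun k => binary (n + k)).take 11 =
      (List.range 11).map fun k => binary (n + k) := by
    intro n l hl
    rw [← List.map_take, List.take_range, min_eq_left hl]
  have hpos : 0 < x.length := List.length_pos_iff.2 hx
  by_cases hl : x.length ≤ 10
  · simp only [commonFactors, List.mem_filter, List.mem_dedup, List.mem_flatMap, List.mem_map,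
      List.mem_range, List.any_eq_true, beq_iff_eq]
    refine ⟨⟨_, window_mem i, x.length - 1, by omega, ?_⟩, _, window_mem j, ?_⟩
    · rw [htake _ _ (by omega), show x.length - 1 + 1 = x.length by omega]
      exact hi.symm
    · rw [htake _ _ (by omega)]
      exact hj.symm
  · exfalso
    refine comp_window_notMem _ (window_mem i) ?_
    have h3 : comp ((List.range 11).map fun k => binary (i + k)) =
        (List.range 11).map fun k => binary (j + k) := by
      rw [← htake' i x.length (by omega), ← hi, ← htake' j x.length (by omega), ← hj, comp, comp,
        List.map_take]
    rw [h3]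
    exact window_mem j

/-! ### Runs of the binary word -/

theorem binary_codeCut (j : ℕ) : binary (codeCut j) = false := by
  rcases ternary_cases j with h | h | h
  · exact (codeCut_of_zero h).2.1
  · exact (codeCut_of_one h).2
  · exact (codeCut_of_two h).2.1

theorem exists_codeCut_of_double_true {t : ℕ} (h1 : binary t = true)
    (h2 : binary (t + 1) = true) : ∃ a, codeCut a + 1 = t := by
  obtain ⟨j, h3, h4⟩ := isConcat_binary.exists_block t
  refine ⟨j, ?_⟩
  have h5 := binary_codeCut (j + 1)
  obtain ⟨r, rfl⟩ := Nat.exists_eq_add_of_le h3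
  rcases ternary_cases j with h | h | h
  · obtain ⟨h6, h7⟩ := codeCut_of_zero h
    rw [h6] at h4 h5
    have hr : r < 6 := by omega
    interval_cases r <;> simp_all
  · have h6 := codeCut_of_one h
    rw [h6.1] at h4
    obtain rfl : r = 0 := by omega
    simp_all
  · obtain ⟨h6, h7⟩ := codeCut_of_two h
    rw [h6] at h4 h5
    have hr : r < 5 := by omega
    interval_cases r <;> simp_all

theorem code_mismatch_right {f f' : ℕ} (h : ternary f ≠ ternary f') :
    binary (codeCut f + rightExt 0 ((ternary f).val + (ternary f').val)) ≠
      binary (codeCut f' + rightExt 0 ((ternary f).val + (ternary f').val)) := by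
  have key : ∀ i, ternary i = 1 → binary (codeCut i + 1) = false := by
    intro i hi
    rw [← (codeCut_of_one hi).1, binary_codeCut]
  rcases ternary_cases f with hf | hf | hf <;> rcases ternary_cases f' with hf' | hf' | hf' <;>
    first
    | exact absurd (hf.trans hf'.symm) h
    | simp [hf, hf', rightExt, codeCut_of_zero, codeCut_of_two, key]

theorem code_mismatch_left {s s' : ℕ} (h : ternary s ≠ ternary s') :
    ∃ x y, codeCut (s + 1) = x + 1 + leftExt 0 ((ternary s).val + (ternary s').val) ∧
      codeCut (s' + 1) = y + 1 + leftExt 0 ((ternary s).val + (ternary s').val) ∧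
      binary x ≠ binary y := by
  rcases ternary_cases s with hs | hs | hs <;> rcases ternary_cases s' with hs' | hs' | hs'
  · exact absurd (hs.trans hs'.symm) h
  · exact ⟨codeCut s + 5, codeCut s', by
      simp [hs, hs', leftExt, codeCut_of_zero, codeCut_of_one]⟩
  · exact ⟨codeCut s + 3, codeCut s' + 2, by
      simp [hs, hs', leftExt, codeCut_of_zero, codeCut_of_two]⟩
  · exact ⟨codeCut s, codeCut s' + 5, by
      simp [hs, hs', leftExt, codeCut_of_zero, codeCut_of_one]⟩
  · exact absurd (hs.trans hs'.symm) h
  · exact ⟨codeCut s, codeCut s' + 4, by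
      simp [hs, hs', leftExt, codeCut_of_two, codeCut_of_one]⟩
  · exact ⟨codeCut s + 2, codeCut s' + 3, by
      simp [hs, hs', leftExt, codeCut_of_zero, codeCut_of_two]⟩
  · exact ⟨codeCut s + 4, codeCut s', by
      simp [hs, hs', leftExt, codeCut_of_two, codeCut_of_one]⟩
  · exact absurd (hs.trans hs'.symm) h

theorem binary_run_le {β : ℝ} (hβ : β ^ 3 - 2 * β ^ 2 + β - 1 = 0) (hβ1 : 1.7548 < β)
    (hβ2 : β < 1.7549) {i m q : ℕ} (hq : 1 ≤ q)
    (heq : ∀ k < m, binary (i + k) = binary (i + k + q)) :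
    (m : ℝ) ≤ (2 * β ^ 2 - β + 3) / 5 * q := by
  have hγ : 1.48 < (2 * β ^ 2 - β + 3) / 5 := by nlinarith
  have hwin : ∀ k < 11, ((List.range 11).map fun k => binary (i + k))[k]? =
      some (binary (i + k)) := by
    intro k hk
    simp [hk]
  by_cases hm : m ≤ 7
  · by_cases hq5 : 5 ≤ q
    · have h1 : (m : ℝ) ≤ 7 := by exact_mod_cast hm
      have h2 : (5 : ℝ) ≤ q := by exact_mod_cast hq5
      nlinarith
    · have hshort : ∀ n, (q, n) ∈ [(1, 2), (2, 3), (3, 5), (4, 6)] → m < n := by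
        intro n hn
        by_contra! hnm
        obtain ⟨k, hk, hne⟩ := window_short_period _ (window_mem i) _ hn
        have hn6 : n ≤ 6 := by simp at hn; omega
        simp only at hk hne
        rw [hwin _ (by omega), hwin _ (by omega)] at hne
        exact hne (by rw [heq k (by omega), add_assoc])
      obtain ⟨n, hn, hnq⟩ : ∃ n : ℕ, (q, n) ∈ [(1, 2), (2, 3), (3, 5), (4, 6)] ∧
          (n : ℝ) - 1 ≤ 1.48 * q := by
        interval_cases q
        · exact ⟨2, by simp, by norm_num⟩
        · exact ⟨3, by simp, by norm_num⟩
        · exact ⟨5, by simp, by norm_num⟩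
        · exact ⟨6, by simp, by norm_num⟩
      have h1 : (m + 1 : ℝ) ≤ n := by exact_mod_cast hshort n hn
      have h2 : (1 : ℝ) ≤ q := by exact_mod_cast hq
      nlinarith
  · obtain ⟨t, ht, ht1, ht2⟩ := window_double_true _ (window_mem i)
    rw [hwin _ (by omega)] at ht1 ht2
    have ht1' := Option.some.inj ht1
    have ht2' := Option.some.inj ht2
    obtain ⟨a, ha⟩ := exists_codeCut_of_double_true ht1' (by rwa [add_assoc])
    obtain ⟨b, hb⟩ := exists_codeCut_of_double_true (t := i + t + q)
      (by rw [← heq t (by omega)]; exact ht1')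
      (by rw [← ht2', heq (t + 1) (by omega)]; congr 1; omega)
    have hmono := isConcat_binary.start_strictMono
    have hab : a < b := hmono.lt_iff_lt.1 (by omega)
    obtain ⟨s, f, hsa, haf, hrun⟩ := exists_maxRun a (q := b - a) (by omega)
    have hshift : ∀ j, s ≤ j → j ≤ f → codeCut (j + (b - a)) = codeCut j + q := by
      intro j h1 h2
      have h3 := additive_shift (φ := fun a => (code a).length) codeCut_succ hrun.eq le_rfl h1 h2
      have h4 := additive_shift (φ := fun a => (code a).length) codeCut_succ hrun.eq le_rfl hsa haf
      rw [show a + (b - a) = b by omega] at h4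
      omega
    have h1 := hmono.monotone hsa
    have h2 := hmono.monotone haf
    have hright : i + m ≤ codeCut f + rightExt 0 (rightType f (b - a)) := by
      by_contra! hlt
      have h3 : 1 ≤ rightExt 0 (rightType f (b - a)) := by
        simp only [rightExt]
        split_ifs <;> omega
      have h4 := code_mismatch_right hrun.ne_right
      rw [hshift f hrun.le le_rfl] at h4
      change binary (codeCut f + rightExt 0 (rightType f (b - a))) ≠
        binary (codeCut f + q + rightExt 0 (rightType f (b - a))) at h4
      have h5 := heq (codeCut f + rightExt 0 (rightType f (b - a)) - i) (by omega)
      rw [show i + (codeCut f + rightExt 0 (rightType f (b - a)) - i) =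
        codeCut f + rightExt 0 (rightType f (b - a)) by omega] at h5
      exact h4 (by rw [h5]; congr 1; omega)
    have hleft : codeCut s ≤ i + leftExt 0 (leftType s (b - a)) := by
      rcases s with _ | s
      · have := isConcat_binary.start_zero
        omega
      · obtain ⟨x, y, h3, h4, h5⟩ := code_mismatch_left (hrun.ne_left s rfl)
        rw [show s + (b - a) + 1 = s + 1 + (b - a) by omega, hshift (s + 1) le_rfl hrun.le] at h4
        change codeCut (s + 1) = x + 1 + leftExt 0 (leftType (s + 1) (b - a)) at h3
        change codeCut (s + 1) + q = y + 1 + leftExt 0 (leftType (s + 1) (b - a)) at h4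
        by_contra! hlt
        have h6 := heq (x - i) (by omega)
        rw [show i + (x - i) = x by omega] at h6
        exact h5 (by rw [h6]; congr 1; omega)
    have hbound := hrun.bound (by linarith) (critical_zero hβ hβ1 hβ2)
      (critical_one hβ hβ1 hβ2) 0
    rw [prefixLen_level_zero, prefixLen_level_zero, prefixLen_level_zero,
      hshift s le_rfl hrun.le] at hbound
    push_cast at hbound
    rw [add_sub_cancel_left] at hbound
    have hr' : (i + m : ℝ) ≤ codeCut f + rightExt 0 (rightType f (b - a)) := by
      exact_mod_cast hright
    have hl' : (codeCut s : ℝ) ≤ i + leftExt 0 (leftType s (b - a)) := by exact_mod_cast hleft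
    linarith

theorem expo_le_of_factor {β : ℝ} (hβ : β ^ 3 - 2 * β ^ 2 + β - 1 = 0) (hβ1 : 1.7548 < β)
    (hβ2 : β < 1.7549) {x : List Bool} (hx : FactorN binary x) :
    expo x ≤ 2 + 1 / (β ^ 2 - 1) := by
  obtain ⟨i, hi⟩ := hx
  have hne : {p | HasPeriod x p}.Nonempty := ⟨x.length + 1, by omega, fun _ _ => by omega⟩
  have hp : HasPeriod x (minPeriod x) := Nat.sInf_mem hne
  have hp0 : (0 : ℝ) < minPeriod x := by exact_mod_cast hp.1
  have hget : ∀ k < x.length, x[k]? = some (binary (i + k)) := by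
    intro k hk
    rw [hi]
    simp [hk]
  have hrun := binary_run_le hβ hβ1 hβ2 (i := i) (m := x.length - minPeriod x) hp.1 (by
    intro k hk
    have h1 := hp.2 k (by omega)
    rw [hget _ (by omega), hget _ (by omega)] at h1
    rw [Option.some.inj h1, add_assoc])
  have hlen : (x.length : ℝ) ≤ (x.length - minPeriod x : ℕ) + minPeriod x := by
    exact_mod_cast le_tsub_add
  have hγ := inv_sq_sub_one hβ hβ1
  rw [expo, div_le_iff₀ hp0]
  rw [← hγ] at hrun
  nlinarith

end ComplementAvoidance

theorem stmt11 :
    ∃ w : ℕ → Bool,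
      (∃ β : ℝ, β ^ 3 - 2 * β ^ 2 + β - 1 = 0 ∧
        (∀ t : ℝ, t ^ 3 - 2 * t ^ 2 + t - 1 = 0 → t = β) ∧
        (∀ x : List Bool, FactorN w x → x ≠ [] → expo x ≤ (2 + 1 / (β ^ 2 - 1)))) ∧
      ∃ F : Finset (List Bool), F.card ≤ 64 ∧
        ∀ x : List Bool, x ≠ [] → FactorN w x → FactorN w (comp x) → x ∈ F := by
  obtain ⟨β, hβ, hβ1, hβ2⟩ := ComplementAvoidance.exists_root
  refine ⟨ComplementAvoidance.binary,
    ⟨β, hβ, fun t ht => ComplementAvoidance.root_unique hβ hβ1 ht,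
      fun x hx _ => ComplementAvoidance.expo_le_of_factor hβ hβ1 hβ2 hx⟩,
    ComplementAvoidance.commonFactors.toFinset,
    (List.toFinset_card_le _).trans ComplementAvoidance.commonFactors_card,
    fun x hx h1 h2 => List.mem_toFinset.2 (ComplementAvoidance.mem_commonFactors hx h1 h2)⟩
end

section
/- There exists an infinite binary word w that is (7/3)⁺-free such that the set of nonempty binary words x for which both x and its complement x̄ are factors of w has at most 90 elements. -/
/-- The Thue–Morse word. -/
def thueMorse (n : ℕ) : Bool :=
  if n = 0 then false else xor (n % 2 == 1) (thueMorse (n / 2))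

theorem thueMorse_two_mul (n : ℕ) : thueMorse (2 * n) = thueMorse n := by
  rcases Nat.eq_zero_or_pos n with rfl | hn
  · simp
  · rw [thueMorse, if_neg (by omega)]
    simp

theorem thueMorse_two_mul_add_one (n : ℕ) : thueMorse (2 * n + 1) = !thueMorse n := by
  rw [thueMorse, if_neg (by omega)]
  simp [Nat.add_mod, show (2 * n + 1) / 2 = n by omega]

theorem thueMorse_succ_of_even {n : ℕ} (hn : n % 2 = 0) :
    thueMorse (n + 1) = !thueMorse n := by
  obtain ⟨k, rfl⟩ : ∃ k, n = 2 * k := ⟨n / 2, by omega⟩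
  rw [thueMorse_two_mul_add_one, thueMorse_two_mul]

theorem thueMorse_succ_of_mod_four {n : ℕ} (hn : n % 4 = 1) :
    thueMorse (n + 1) = thueMorse n := by
  obtain ⟨k, rfl⟩ : ∃ k, n = 2 * (2 * k) + 1 := ⟨n / 4, by omega⟩
  rw [thueMorse_two_mul_add_one, show 2 * (2 * k) + 1 + 1 = 2 * (2 * k + 1) by ring,
    thueMorse_two_mul, thueMorse_two_mul_add_one, thueMorse_two_mul]

/-- The Thue–Morse word contains no overlap. -/
theorem thueMorse_overlapFree (p : ℕ) (hp : 1 ≤ p) (i : ℕ) :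
    ¬ ∀ k ≤ p, thueMorse (i + k) = thueMorse (i + k + p) := by
  induction p using Nat.strong_induction_on generalizing i with
  | _ p ih =>
    intro h
    rcases Nat.even_or_odd' p with ⟨s, rfl | rfl⟩
    · refine ih s (by omega) (by omega) (i / 2) fun k hk => ?_
      have e := h (2 * k) (by omega)
      rcases Nat.mod_two_eq_zero_or_one i with hi | hi
      · rw [show i + 2 * k = 2 * (i / 2 + k) by omega, thueMorse_two_mul, ← mul_add,
          thueMorse_two_mul] at e
        exact e
      · rw [show i + 2 * k = 2 * (i / 2 + k) + 1 by omega,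
          show 2 * (i / 2 + k) + 1 + 2 * s = 2 * (i / 2 + k + s) + 1 by ring,
          thueMorse_two_mul_add_one, thueMorse_two_mul_add_one] at e
        exact Bool.not_inj e
    · rcases Nat.eq_zero_or_pos s with rfl | hs
      · have e₀ := h 0 (by omega)
        have e₁ := h 1 (by omega)
        simp only [mul_zero, zero_add, add_zero] at e₀ e₁
        rcases Nat.mod_two_eq_zero_or_one i with hi | hi
        · rw [thueMorse_succ_of_even hi] at e₀
          simp at e₀
        · rw [thueMorse_succ_of_even (n := i + 1) (by omega)] at e₁
          simp at e₁
      · -- an odd period transports the alternation at even positions to odd ones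
        have alt : ∀ k, k < 2 * s + 1 → thueMorse (i + k + 1) = !thueMorse (i + k) := by
          intro k hk
          rcases Nat.mod_two_eq_zero_or_one (i + k) with hi | hi
          · exact thueMorse_succ_of_even hi
          · have e₀ := h k (by omega)
            have e₁ := h (k + 1) (by omega)
            rw [e₀, show i + k + 1 = i + (k + 1) by ring, e₁,
              show i + (k + 1) + (2 * s + 1) = i + k + (2 * s + 1) + 1 by ring]
            exact thueMorse_succ_of_even (by omega)
        have alt' : ∀ k, k < 2 * s + 1 →
            thueMorse (i + k + (2 * s + 1) + 1) = !thueMorse (i + k + (2 * s + 1)) := by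
          intro k hk
          rw [← h k (by omega), ← alt k hk, show i + k + 1 = i + (k + 1) by ring,
            h (k + 1) (by omega)]
          congr 1
          ring
        obtain ⟨j, hj, hj4⟩ : ∃ j, j < 4 ∧ (i + j) % 4 = 1 := by
          have : i % 4 < 4 := Nat.mod_lt _ (by omega)
          exact ⟨(5 - i % 4) % 4, by omega, by omega⟩
        have same := thueMorse_succ_of_mod_four hj4
        by_cases hjs : j < 2 * s + 1
        · rw [alt j hjs] at same
          simp at same
        · have e := alt' (j - (2 * s + 1)) (by omega)
          rw [show i + (j - (2 * s + 1)) + (2 * s + 1) = i + j by omega, same] at e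
          simp at e

/-- The image of a letter under a 94-uniform morphism, read from the least significant bit. -/
def block : Bool → ℕ
  | false => 6004235980346516954437807283
  | true => 5818816921910485038679878835

/-- The image of the Thue–Morse word under the morphism `block`. -/
def blockWord (n : ℕ) : Bool := (block (thueMorse (n / 94))).testBit (n % 94)

theorem blockWord_add (j r : ℕ) (hr : r < 94) :
    blockWord (94 * j + r) = (block (thueMorse j)).testBit r := by
  rw [blockWord, show (94 * j + r) / 94 = j by omega, show (94 * j + r) % 94 = r by omega]

/-- The image of a finite word under the morphism `block`. -/
def blocks : List Bool → ℕ
  | [] => 0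
  | a :: l => 2 ^ 94 * blocks l + block a

theorem testBit_blocks (l : List Bool) (j r : ℕ) (hr : r < 94) (hj : j < l.length) :
    (blocks l).testBit (94 * j + r) = (block l[j]).testBit r := by
  induction l generalizing j with
  | nil => simp at hj
  | cons a l ih =>
    have ha : block a < 2 ^ 94 := by cases a <;> decide
    rw [blocks, Nat.testBit_two_pow_mul_add _ ha]
    cases j with
    | zero => simp [hr]
    | succ j =>
      rw [if_neg (by omega), show 94 * (j + 1) + r - 94 = 94 * j + r by omega,
        ih j (by simpa using hj)]
      simp

theorem blockWord_eq_testBit_blocks (l : List Bool) (s : ℕ)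
    (hl : ∀ j (hj : j < l.length), l[j] = thueMorse (s + j)) (r : ℕ) (hr : r < 94 * l.length) :
    blockWord (94 * s + r) = (blocks l).testBit r := by
  have hj : r / 94 < l.length := by omega
  have e := testBit_blocks l (r / 94) (r % 94) (by omega) hj
  rw [Nat.div_add_mod] at e
  rw [e, hl, ← blockWord_add _ _ (by omega)]
  congr 1
  omega

theorem blockWord_eq_pair (s r : ℕ) (hr : r < 188) :
    blockWord (94 * s + r) = (blocks [thueMorse s, thueMorse (s + 1)]).testBit r := by
  refine blockWord_eq_testBit_blocks _ s (fun j hj => ?_) r (by simpa using hr)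
  simp only [List.length_cons, List.length_nil] at hj
  interval_cases j <;> rfl

/-- The image of `a b` under the square of the Thue–Morse morphism. -/
def thueMorseSquare (a b : Bool) : List Bool := [a, !a, !a, a, b, !b, !b, b]

theorem thueMorse_four_mul_add (s : ℕ) :
    thueMorse (4 * s) = thueMorse s ∧ thueMorse (4 * s + 1) = !thueMorse s ∧
      thueMorse (4 * s + 2) = !thueMorse s ∧ thueMorse (4 * s + 3) = thueMorse s := by
  refine ⟨?_, ?_, ?_, ?_⟩
  · rw [show 4 * s = 2 * (2 * s) by ring, thueMorse_two_mul, thueMorse_two_mul]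
  · rw [show 4 * s + 1 = 2 * (2 * s) + 1 by ring, thueMorse_two_mul_add_one, thueMorse_two_mul]
  · rw [show 4 * s + 2 = 2 * (2 * s + 1) by ring, thueMorse_two_mul, thueMorse_two_mul_add_one]
  · rw [show 4 * s + 3 = 2 * (2 * s + 1) + 1 by ring, thueMorse_two_mul_add_one,
      thueMorse_two_mul_add_one, Bool.not_not]

theorem blockWord_eq_octet (s r : ℕ) (hr : r < 752) :
    blockWord (376 * s + r) =
      (blocks (thueMorseSquare (thueMorse s) (thueMorse (s + 1)))).testBit r := by
  rw [show 376 * s = 94 * (4 * s) by ring]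
  refine blockWord_eq_testBit_blocks _ (4 * s) (fun j hj => ?_) r
    (by simpa [thueMorseSquare] using hr)
  simp only [thueMorseSquare, List.length_cons, List.length_nil] at hj
  obtain ⟨h₀, h₁, h₂, h₃⟩ := thueMorse_four_mul_add s
  obtain ⟨h₄, h₅, h₆, h₇⟩ := thueMorse_four_mul_add (s + 1)
  interval_cases j <;> symm
  exacts [h₀, h₁, h₂, h₃, h₄, h₅, h₆, h₇]

/-- Bit `r` of `orWindow x m` is the disjunction of the bits `r, …, r + m - 1` of `x`. -/
def orWindow (x : ℕ) : ℕ → ℕ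
  | 0 => 0
  | m + 1 => orWindow x m ||| (x >>> m)

theorem testBit_orWindow_eq_false {x r m : ℕ} (h : ∀ k < m, x.testBit (r + k) = false) :
    (orWindow x m).testBit r = false := by
  induction m with
  | zero => simp [orWindow]
  | succ m ih =>
    rw [orWindow, Nat.testBit_or, Nat.testBit_shiftRight, ih fun k hk => h k (by omega),
      add_comm m r, h m (by omega), Bool.or_false]

/-- Short periods: a finite computation. -/
theorem orWindow_blocks (a b : Bool) :
    ∀ p < 141, 0 < p →
      orWindow (blocks (thueMorseSquare a b) ^^^ (blocks (thueMorseSquare a b) >>> p))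
        (4 * p / 3 + 1) % 2 ^ 376 = 2 ^ 376 - 1 := by
  revert a b
  decide +kernel

theorem Nat.shiftRight_mod_two_pow_eq {x y i j m : ℕ}
    (h : ∀ k < m, x.testBit (i + k) = y.testBit (j + k)) :
    (x >>> i) % 2 ^ m = (y >>> j) % 2 ^ m := by
  refine Nat.eq_of_testBit_eq fun k => ?_
  simp only [Nat.testBit_mod_two_pow, Nat.testBit_shiftRight]
  by_cases hk : k < m
  · rw [h k hk]
  · simp [hk]

/-- No image of a letter occurs in the image of two letters at an interior position. -/
theorem block_synchronizing (a b c : Bool) :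
    ∀ r < 94, 0 < r → (blocks [b, c] >>> r) % 2 ^ 94 ≠ (block a >>> 0) % 2 ^ 94 := by
  revert a b c
  decide +kernel

theorem block_testBit_injective {r : ℕ} (hr : r = 18 ∨ r = 88) {a b : Bool}
    (h : (block a).testBit r = (block b).testBit r) : a = b := by
  rcases hr with rfl | rfl <;> revert a b <;> decide

/-- Every factor of `blockWord` has exponent at most `7 / 3`. -/
theorem blockWord_powerFree (i p : ℕ) (hp : 0 < p) :
    ¬ ∀ k, 3 * k ≤ 4 * p → blockWord (i + k) = blockWord (i + k + p) := by
  intro h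
  by_cases hsmall : p < 141
  · have full := congrArg (Nat.testBit · (i % 376))
      (orWindow_blocks (thueMorse (i / 376)) (thueMorse (i / 376 + 1)) p hsmall hp)
    have hlt : i % 376 < 376 := Nat.mod_lt _ (by omega)
    simp only [Nat.testBit_mod_two_pow, Nat.testBit_two_pow_sub_one, hlt, decide_true,
      Bool.true_and] at full
    rw [testBit_orWindow_eq_false fun k hk => ?_] at full
    · exact Bool.false_ne_true full
    · rw [Nat.testBit_xor, Nat.testBit_shiftRight, ← blockWord_eq_octet _ _ (by omega),
        ← blockWord_eq_octet _ _ (by omega), ← add_assoc,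
        show 376 * (i / 376) + i % 376 = i from Nat.div_add_mod i 376,
        h k (by omega), bne_eq_false_iff_eq]
      congr 1
      omega
  · by_cases hdvd : p % 94 = 0
    · obtain ⟨s, rfl⟩ : ∃ s, p = 94 * s := ⟨p / 94, by omega⟩
      -- a block matches as soon as one of its positions 18, 88 lies in the repetition
      have key : ∀ j r, r = 18 ∨ r = 88 → i ≤ 94 * j + r → 3 * (94 * j + r) ≤ 3 * i + 376 * s →
          thueMorse j = thueMorse (j + s) := by
        intro j r hr h₁ h₂
        have e := h (94 * j + r - i) (by omega)
        rw [show i + (94 * j + r - i) = 94 * j + r by omega,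
          show 94 * j + r + 94 * s = 94 * (j + s) + r by ring,
          blockWord_add _ _ (by omega), blockWord_add _ _ (by omega)] at e
        exact block_testBit_injective hr e
      refine thueMorse_overlapFree s (by omega) ((i + 5) / 94) fun k hk => ?_
      rcases Nat.eq_zero_or_pos k with rfl | hk₀
      · exact key _ 88 (Or.inr rfl) (by omega) (by omega)
      · exact key _ 18 (Or.inl rfl) (by omega) (by omega)
    · refine block_synchronizing (thueMorse ((i + 93) / 94)) (thueMorse ((i + 93) / 94 + p / 94))
        (thueMorse ((i + 93) / 94 + p / 94 + 1)) (p % 94) (Nat.mod_lt _ (by omega)) (by omega)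
        (Nat.shiftRight_mod_two_pow_eq fun k hk => ?_)
      rw [← blockWord_eq_pair _ _ (by omega), zero_add, ← blockWord_add _ _ hk]
      have e := h (94 * ((i + 93) / 94) + k - i) (by omega)
      rw [show i + (94 * ((i + 93) / 94) + k - i) = 94 * ((i + 93) / 94) + k by omega] at e
      rw [e]
      congr 1
      omega

/-- Codes of the factors of length 13 of `blockWord`. -/
def factorCodes : List ℕ :=
  ([[false, false], [false, true], [true, false], [true, true]].flatMap fun l =>
    (List.range 94).map fun r => (blocks l >>> r) % 2 ^ 13).dedup

/-- Codes, paired with their lengths, of the factors of `blockWord` of length at most 12 whose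
complements are factors. -/
def complementaryCodes : List (ℕ × ℕ) :=
  (List.range' 1 12).flatMap fun l =>
    ((factorCodes.map (· % 2 ^ l)).dedup.filter fun v =>
      2 ^ l - 1 - v ∈ factorCodes.map (· % 2 ^ l)).map fun v => (l, v)

theorem length_complementaryCodes : complementaryCodes.length ≤ 90 := by
  decide +kernel

theorem complement_notMem_factorCodes : ∀ v ∈ factorCodes, 2 ^ 13 - 1 - v ∉ factorCodes := by
  decide +kernel

theorem exists_mem_factorCodes (i : ℕ) :
    ∃ v ∈ factorCodes, ∀ k < 13, v.testBit k = blockWord (i + k) := by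
  refine ⟨(blocks [thueMorse (i / 94), thueMorse (i / 94 + 1)] >>> (i % 94)) % 2 ^ 13, ?_,
    fun k hk => ?_⟩
  · rw [factorCodes, List.mem_dedup, List.mem_flatMap]
    refine ⟨[thueMorse (i / 94), thueMorse (i / 94 + 1)], ?_, ?_⟩
    · cases thueMorse (i / 94) <;> cases thueMorse (i / 94 + 1) <;> simp
    · exact List.mem_map.2 ⟨i % 94, List.mem_range.2 (Nat.mod_lt _ (by omega)), rfl⟩
  · rw [Nat.testBit_mod_two_pow, Nat.testBit_shiftRight, ← blockWord_eq_pair _ _ (by omega),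
      show 94 * (i / 94) + (i % 94 + k) = i + k by omega]
    simp [hk]

theorem mod_two_pow_eq_of_testBit_eq_not {u v l : ℕ}
    (h : ∀ k < l, u.testBit k = !v.testBit k) : u % 2 ^ l = 2 ^ l - 1 - v % 2 ^ l := by
  refine Nat.eq_of_testBit_eq fun k => ?_
  rw [Nat.sub_sub, Nat.add_comm 1,
    Nat.testBit_two_pow_sub_succ (Nat.mod_lt _ (Nat.two_pow_pos l))]
  simp only [Nat.testBit_mod_two_pow]
  by_cases hk : k < l
  · simp [hk, h k hk]
  · simp [hk]

/-- A pair of complementary factors of `blockWord` has length at most 12. -/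
theorem lt_of_blockWord_complement {i j l : ℕ}
    (h : ∀ k < l, blockWord (j + k) = !blockWord (i + k)) : l < 13 := by
  by_contra hl
  obtain ⟨u, hu, hu'⟩ := exists_mem_factorCodes i
  obtain ⟨v, hv, hv'⟩ := exists_mem_factorCodes j
  have lt : ∀ x ∈ factorCodes, x < 2 ^ 13 := by decide +kernel
  have e := mod_two_pow_eq_of_testBit_eq_not (u := v) (v := u) (l := 13) fun k hk => by
    rw [hu' k hk, hv' k hk, h k (by omega)]
  rw [Nat.mod_eq_of_lt (lt u hu), Nat.mod_eq_of_lt (lt v hv)] at e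
  exact complement_notMem_factorCodes u hu (e ▸ hv)

/-- A complementary factor of `blockWord` has its code in `complementaryCodes`. -/
theorem exists_mem_complementaryCodes {i j l : ℕ} (hl : 0 < l)
    (h : ∀ k < l, blockWord (j + k) = !blockWord (i + k)) :
    ∃ v, (l, v) ∈ complementaryCodes ∧ ∀ k < l, v.testBit k = blockWord (i + k) := by
  have hl' := lt_of_blockWord_complement h
  obtain ⟨u, hu, hu'⟩ := exists_mem_factorCodes i
  obtain ⟨v, hv, hv'⟩ := exists_mem_factorCodes j
  refine ⟨u % 2 ^ l, ?_, fun k hk => ?_⟩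
  · rw [complementaryCodes, List.mem_flatMap]
    refine ⟨l, List.mem_range'_1.2 ⟨hl, by omega⟩, List.mem_map_of_mem (List.mem_filter.2 ⟨?_, ?_⟩)⟩
    · exact List.mem_dedup.2 (List.mem_map_of_mem hu)
    · rw [decide_eq_true_eq, ← mod_two_pow_eq_of_testBit_eq_not (u := v) fun k hk => by
        rw [hu' k (by omega), hv' k (by omega), h k hk]]
      exact List.mem_map_of_mem hv
  · rw [Nat.testBit_mod_two_pow, hu' k (by omega)]
    simp [hk]

theorem FactorN.exists_getElem? {α : Type*} {w : ℕ → α} {x : List α} (h : FactorN w x) :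
    ∃ i, ∀ k < x.length, x[k]? = some (w (i + k)) := by
  obtain ⟨i, hi⟩ := h
  refine ⟨i, fun k hk => ?_⟩
  rw [hi]
  simp [hk]

theorem hasPeriod_minPeriod {α : Type*} {x : List α} (hx : x ≠ []) :
    HasPeriod x (minPeriod x) :=
  Nat.sInf_mem (s := {p | HasPeriod x p})
    ⟨x.length, List.length_pos_of_ne_nil hx, fun _ hi => by omega⟩

theorem stmt12 :
    ∃ w : ℕ → Bool,
      (∀ x : List Bool, FactorN w x → x ≠ [] → expo x ≤ (7 : ℝ) / 3) ∧
      ∃ F : Finset (List Bool), F.card ≤ 90 ∧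
        ∀ x : List Bool, x ≠ [] → FactorN w x → FactorN w (comp x) → x ∈ F := by
  refine ⟨blockWord, fun x hx hne => ?_,
    (complementaryCodes.toFinset).image fun c => (List.range c.1).map fun k => c.2.testBit k,
    Finset.card_image_le.trans ((List.toFinset_card_le _).trans length_complementaryCodes),
    fun x hne hx hxc => ?_⟩
  · obtain ⟨i, hi⟩ := hx.exists_getElem?
    obtain ⟨hp, hper⟩ := hasPeriod_minPeriod hne
    rw [expo, div_le_div_iff₀ (by exact_mod_cast hp) (by norm_num)]
    by_contra! hlt
    have hlt' : 7 * minPeriod x < x.length * 3 := by exact_mod_cast hlt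
    refine blockWord_powerFree i (minPeriod x) hp fun k hk => ?_
    have e := hper k (by omega)
    rw [hi _ (by omega), hi _ (by omega), Option.some_inj] at e
    rw [e, add_assoc]
  · obtain ⟨i, hi⟩ := hx.exists_getElem?
    obtain ⟨j, hj⟩ := hxc.exists_getElem?
    obtain ⟨v, hv, hv'⟩ := exists_mem_complementaryCodes (i := i) (j := j)
      (List.length_pos_of_ne_nil hne) fun k hk => by
        have e := hj k (by simpa [comp] using hk)
        rw [comp, List.getElem?_map, hi k hk] at e
        simpa using e.symm
    refine Finset.mem_image.2 ⟨_, List.mem_toFinset.2 hv, List.ext_getElem? fun k => ?_⟩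
    by_cases hk : k < x.length
    · rw [hi k hk, ← hv' k hk]
      simp [hk]
    · simp [hk]
end
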